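/- Among the cluster configurations of the regular heptagon Π: exactly 224 contain precisely one short paired diagonal and no long paired diagonal; exactly 175 contain precisely two short paired diagonals and no long paired diagonal; and exactly 84 contain no paired diagonal at all. All these cluster configurations are pairwise distinct, and together with the 350 configurations containing a long paired diagonal they account for all 833 cluster configurations. -/

import Mathlib

/-!
The combinatorial model of the cluster category `C_{E₆}` by coloured oriented
single and paired diagonals of a regular heptagon, following L. Lamberti,
"Combinatorial model for the cluster categories of type E", Section 5.

The vertices of the heptagon `Π` are labelled by `ZMod 7` (clockwise; the
label `7` is the same as `0`).  `Π_{1,2,2}` consists of the 42 diagonals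
`[i,i+2]_P, [i,i+3]_P, [i,i+4]_R, [i,i+5]_R, [i+4,i]_B, [i+5,i]_B`.
-/

inductive Colour : Type
  | R : Colour
  | B : Colour
  | P : Colour
deriving DecidableEq

/-- A coloured oriented (single or paired) diagonal `[i,j]_c` of the regular
heptagon. -/
structure Dg where
  i : ZMod 7
  j : ZMod 7
  c : Colour
deriving DecidableEq

/-- Abbreviation for entering diagonals by natural-number labels. -/
def dg (a b : ℕ) (c : Colour) : Dg := ⟨(a : ZMod 7), (b : ZMod 7), c⟩

/-- `ρ`: simultaneous change of colour and orientation. -/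
def rho : Dg → Dg
  | ⟨i, j, Colour.R⟩ => ⟨j, i, Colour.B⟩
  | ⟨i, j, Colour.B⟩ => ⟨j, i, Colour.R⟩
  | ⟨i, j, Colour.P⟩ => ⟨i, j, Colour.P⟩

/-- The rotation `[i,j]_c ↦ [i-1,j-1]_c`. -/
def shiftD (d : Dg) : Dg := ⟨d.i - 1, d.j - 1, d.c⟩

/-- The 42 coloured oriented single and paired diagonals `Π_{1,2,2}` of the
heptagon. -/
def InPi (d : Dg) : Prop :=
  ∃ i : ZMod 7, d = ⟨i, i + 2, Colour.P⟩ ∨ d = ⟨i, i + 3, Colour.P⟩ ∨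
    d = ⟨i, i + 4, Colour.R⟩ ∨ d = ⟨i, i + 5, Colour.R⟩ ∨
    d = ⟨i + 4, i, Colour.B⟩ ∨ d = ⟨i + 5, i, Colour.B⟩

/-- The first slice `Π_{1,2,2}|_1` of the quiver `Γ := Γ^7_{1,2,2}`. -/
def firstSlice : List Dg :=
  [dg 1 3 Colour.P, dg 1 4 Colour.P, dg 1 5 Colour.R, dg 1 6 Colour.R,
   dg 5 1 Colour.B, dg 6 1 Colour.B]

/-- The translation `τ` of `Γ^7_{1,2,2}`: the rotation `[i,j]_c ↦ [i-1,j-1]_c`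
composed with the colour-orientation swap `ρ` on the first slice. -/
def tau7 (d : Dg) : Dg :=
  if d ∈ firstSlice then rho (shiftD d) else shiftD d

/-- The translation applied to a whole collection of diagonals. -/
def tauT (T : Finset Dg) : Finset Dg := T.image tau7

/-- The curves of `(1, 3, 'P')`. -/
def c13 : List (List Dg) :=
  [  [dg 2 4 Colour.P,
   dg 2 5 Colour.P,
   dg 2 6 Colour.R,
   dg 6 2 Colour.B,
   dg 2 7 Colour.R,
   dg 7 2 Colour.B,
   dg 3 7 Colour.R,
   dg 7 3 Colour.B,
   dg 4 7 Colour.P,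
   dg 5 7 Colour.P,
   dg 5 1 Colour.P],
  [dg 7 2 Colour.P,
   dg 6 2 Colour.P,
   dg 5 2 Colour.R,
   dg 2 5 Colour.B,
   dg 4 2 Colour.R,
   dg 2 4 Colour.B,
   dg 4 1 Colour.R,
   dg 1 4 Colour.B,
   dg 4 7 Colour.P,
   dg 4 6 Colour.P,
   dg 3 6 Colour.P]]

/-- The curves of `(1, 4, 'P')`. -/
def c14 : List (List Dg) :=
  [  [dg 2 5 Colour.P,
   dg 2 6 Colour.R,
   dg 6 2 Colour.B,
   dg 2 7 Colour.R,
   dg 7 2 Colour.B,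
   dg 3 7 Colour.R,
   dg 7 3 Colour.B,
   dg 4 7 Colour.P,
   dg 5 7 Colour.P,
   dg 5 1 Colour.P],
  [dg 3 5 Colour.P,
   dg 3 6 Colour.P,
   dg 3 7 Colour.R,
   dg 7 3 Colour.B,
   dg 3 1 Colour.R,
   dg 1 3 Colour.B,
   dg 4 1 Colour.R,
   dg 1 4 Colour.B,
   dg 5 1 Colour.P,
   dg 6 1 Colour.P,
   dg 6 2 Colour.P],
  [dg 7 3 Colour.P,
   dg 7 2 Colour.P,
   dg 6 2 Colour.P,
   dg 5 2 Colour.R,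
   dg 2 5 Colour.B,
   dg 4 2 Colour.R,
   dg 2 4 Colour.B,
   dg 4 1 Colour.R,
   dg 1 4 Colour.B,
   dg 4 7 Colour.P],
  [dg 3 6 Colour.P,
   dg 4 6 Colour.P,
   dg 4 7 Colour.P,
   dg 5 7 Colour.P,
   dg 5 1 Colour.P,
   dg 5 2 Colour.R,
   dg 5 3 Colour.R,
   dg 2 5 Colour.B,
   dg 3 5 Colour.B,
   dg 6 3 Colour.R,
   dg 3 6 Colour.B]]

/-- The curves of `(1, 5, 'R')`. -/
def c15 : List (List Dg) :=
  [  [dg 2 6 Colour.R,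
   dg 3 6 Colour.P,
   dg 4 6 Colour.P,
   dg 4 7 Colour.P,
   dg 4 1 Colour.R,
   dg 4 2 Colour.R,
   dg 5 2 Colour.R],
  [dg 2 7 Colour.R,
   dg 3 7 Colour.R,
   dg 4 7 Colour.P,
   dg 5 7 Colour.P,
   dg 5 1 Colour.P,
   dg 5 2 Colour.R,
   dg 5 3 Colour.R,
   dg 6 3 Colour.R],
  [dg 4 7 Colour.B,
   dg 7 3 Colour.P,
   dg 7 2 Colour.P,
   dg 6 2 Colour.P,
   dg 2 5 Colour.B,
   dg 2 4 Colour.B,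
   dg 1 4 Colour.B],
  [dg 7 3 Colour.B,
   dg 1 3 Colour.B,
   dg 1 4 Colour.B,
   dg 5 1 Colour.P,
   dg 6 1 Colour.P,
   dg 6 2 Colour.P,
   dg 3 6 Colour.B,
   dg 4 6 Colour.B]]

/-- The curves of `(1, 6, 'R')`. -/
def c16 : List (List Dg) :=
  [  [dg 2 7 Colour.R,
   dg 3 7 Colour.R,
   dg 4 7 Colour.P,
   dg 5 7 Colour.P,
   dg 5 1 Colour.P,
   dg 5 2 Colour.R,
   dg 5 3 Colour.R,
   dg 6 3 Colour.R],
  [dg 5 7 Colour.B,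
   dg 4 7 Colour.B,
   dg 7 3 Colour.P,
   dg 7 2 Colour.P,
   dg 6 2 Colour.P,
   dg 2 5 Colour.B,
   dg 2 4 Colour.B,
   dg 1 4 Colour.B]]

/-- The curves of `(5, 1, 'B')`. -/
def c51 : List (List Dg) :=
  [  [dg 6 2 Colour.B,
   dg 3 6 Colour.P,
   dg 4 6 Colour.P,
   dg 4 7 Colour.P,
   dg 1 4 Colour.B,
   dg 2 4 Colour.B,
   dg 2 5 Colour.B],
  [dg 7 2 Colour.B,
   dg 7 3 Colour.B,
   dg 4 7 Colour.P,
   dg 5 7 Colour.P,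
   dg 5 1 Colour.P,
   dg 2 5 Colour.B,
   dg 3 5 Colour.B,
   dg 3 6 Colour.B],
  [dg 7 4 Colour.R,
   dg 7 3 Colour.P,
   dg 7 2 Colour.P,
   dg 6 2 Colour.P,
   dg 5 2 Colour.R,
   dg 4 2 Colour.R,
   dg 4 1 Colour.R],
  [dg 3 7 Colour.R,
   dg 3 1 Colour.R,
   dg 4 1 Colour.R,
   dg 5 1 Colour.P,
   dg 6 1 Colour.P,
   dg 6 2 Colour.P,
   dg 6 3 Colour.R,
   dg 6 4 Colour.R]]

/-- The curves of `(6, 1, 'B')`. -/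
def c61 : List (List Dg) :=
  [  [dg 7 2 Colour.B,
   dg 7 3 Colour.B,
   dg 4 7 Colour.P,
   dg 5 7 Colour.P,
   dg 5 1 Colour.P,
   dg 2 5 Colour.B,
   dg 3 5 Colour.B,
   dg 3 6 Colour.B],
  [dg 7 5 Colour.R,
   dg 7 4 Colour.R,
   dg 7 3 Colour.P,
   dg 7 2 Colour.P,
   dg 6 2 Colour.P,
   dg 5 2 Colour.R,
   dg 4 2 Colour.R,
   dg 4 1 Colour.R]]

/-- The curves `C₁(D), …, C_r(D)` (`r ∈ {2,4}`) attached to each vertex `D`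
of the first slice of `Γ`; each curve is the set of diagonals obtained from
`τ^{∓1}(D)` by a prescribed sequence of minimal clockwise (respectively
anticlockwise) rotations around alternating vertices of `Π`. -/
def curvesBase (d : Dg) : List (List Dg) :=
  if d = dg 1 3 Colour.P then c13
  else if d = dg 1 4 Colour.P then c14
  else if d = dg 1 5 Colour.R then c15
  else if d = dg 1 6 Colour.R then c16
  else if d = dg 5 1 Colour.B then c51
  else if d = dg 6 1 Colour.B then c61
  else []

/-- `Y` lies on the `n`-th curve of `X`: curves of arbitrary vertices of `Γ`
are the `τ`-translates of the curves of the first-slice vertices. -/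
def CurveMem (X : Dg) (n : ℕ) (Y : Dg) : Prop :=
  ∃ (k : ℕ) (b : Dg) (C : List Dg) (z : Dg),
    b ∈ firstSlice ∧ tau7^[k] b = X ∧ (curvesBase b)[n]? = some C ∧
      z ∈ C ∧ tau7^[k] z = Y

open Classical in
/-- `dim_k Ext¹_Π(X, Y)`: the number of curves of `X` on which `Y` lies. -/
noncomputable def extDim (X Y : Dg) : ℕ :=
  ((Finset.range 4).filter fun n => CurveMem X n Y).card

/-- A cluster configuration: six pairwise distinct elements of `Π_{1,2,2}`
with vanishing `Ext¹_Π` between any two of them.  (Under the equivalence of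
the mesh category of `Γ^7_{1,2,2}` with `C_{E₆}`, these correspond exactly to
the cluster tilting sets of the cluster category `C_{E₆}`.) -/
def IsConfig (T : Finset Dg) : Prop :=
  T.card = 6 ∧ (∀ d ∈ T, InPi d) ∧ ∀ x ∈ T, ∀ y ∈ T, extDim x y = 0

/-- `x` lies strictly inside the clockwise arc from `a` to `b`. -/
def inArc (a b x : ZMod 7) : Prop :=
  0 < (x - a).val ∧ (x - a).val < (b - a).val

/-- Two coloured oriented diagonals cross if their underlying chords of `Π`
intersect in an interior point of `Π`. -/
def crosses (a b : Dg) : Prop :=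
  (inArc a.i a.j b.i ∧ inArc a.j a.i b.j) ∨
  (inArc a.i a.j b.j ∧ inArc a.j a.i b.i)

/-- Long paired diagonals `[i,i+3]_P`. -/
def IsLongPaired (d : Dg) : Prop := d.c = Colour.P ∧ d.j - d.i = 3

/-- Short paired diagonals `[i,i+2]_P`. -/
def IsShortPaired (d : Dg) : Prop := d.c = Colour.P ∧ d.j - d.i = 2

/-- `T` contains a long paired diagonal. -/
def HasLong (T : Finset Dg) : Prop := ∃ d ∈ T, IsLongPaired d

open Classical in
/-- The number of short paired diagonals in `T`. -/
noncomputable def shortCount (T : Finset Dg) : ℕ :=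
  (T.filter fun d => IsShortPaired d).card

open Finset in
/-- The cliques `S ⊆ {0, …, n - 1}` with `k` elements, `j` of them in the bit mask `p`, all of them
in the bit mask `c`; the neighbourhood of `a` is the bit mask `adj a`. -/
def maskCliques (adj : ℕ → ℕ) (p n k j c : ℕ) : Finset (Finset ℕ) :=
  {S ∈ (range n).powerset | #S = k ∧ #{a ∈ S | p.testBit a} = j ∧ (∀ a ∈ S, c.testBit a) ∧
    ∀ a ∈ S, ∀ b ∈ S, (adj a).testBit b}

/-- Backtracking count of the elements of `maskCliques`, branching on the largest element of the
bit mask `c`; the first argument bounds the depth of the recursion. -/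
def cliqueCount (adj : ℕ → ℕ) (p : ℕ) : ℕ → ℕ → ℕ → ℕ → ℕ
  | _, 0, j, _ => if j = 0 then 1 else 0
  | 0, _ + 1, _, _ => 0
  | _ + 1, _ + 1, _, 0 => 0
  | n + 1, k + 1, j, c + 1 =>
    cliqueCount adj p n (k + 1) j ((c + 1) % 2 ^ (c + 1).log2) +
      if p.testBit (c + 1).log2 then
        if j = 0 then 0
        else cliqueCount adj p n k (j - 1) ((c + 1) % 2 ^ (c + 1).log2 &&& adj (c + 1).log2)
      else cliqueCount adj p n k j ((c + 1) % 2 ^ (c + 1).log2 &&& adj (c + 1).log2)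

open Finset in
theorem card_maskCliques_zero (adj : ℕ → ℕ) (p n j c : ℕ) :
    #(maskCliques adj p n 0 j c) = if j = 0 then 1 else 0 := by
  have h : maskCliques adj p n 0 j c = if j = 0 then {∅} else ∅ := by
    ext S
    split_ifs with hj
    · simp only [maskCliques, mem_filter, mem_powerset, card_eq_zero, mem_singleton]
      constructor
      · exact fun h => h.2.1
      · rintro rfl
        simp [hj]
    · simp only [maskCliques, mem_filter, mem_powerset, card_eq_zero, notMem_empty, iff_false]
      rintro ⟨-, rfl, h, -⟩
      simp at h
      exact hj h.symm
  rw [h]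
  split_ifs <;> simp

open Finset in
theorem maskCliques_eq_of_lt (adj : ℕ → ℕ) (p : ℕ) {m n : ℕ} (hmn : m ≤ n) (k j : ℕ) {c : ℕ}
    (hc : c < 2 ^ m) : maskCliques adj p n k j c = maskCliques adj p m k j c := by
  ext S
  simp only [maskCliques, mem_filter, mem_powerset]
  refine ⟨fun h => ⟨fun a ha => ?_, h.2⟩, fun h => ⟨h.1.trans (range_mono hmn), h.2⟩⟩
  rw [mem_range]
  by_contra! hma
  have hfalse := Nat.testBit_lt_two_pow (hc.trans_le (Nat.pow_le_pow_right two_pos hma))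
  simp [h.2.2.2.1 a ha] at hfalse

open Finset in
theorem card_maskCliques_succ (adj : ℕ → ℕ) (p n k j c : ℕ)
    (hrefl : (adj n).testBit n)
    (hsymm : ∀ a < n, (adj n).testBit a → (adj a).testBit n) (hc : c.testBit n) :
    #(maskCliques adj p (n + 1) (k + 1) j c) =
      #(maskCliques adj p n (k + 1) j (c % 2 ^ n)) +
        if p.testBit n then
          if j = 0 then 0 else #(maskCliques adj p n k (j - 1) (c % 2 ^ n &&& adj n))
        else #(maskCliques adj p n k j (c % 2 ^ n &&& adj n)) := by
  simp only [maskCliques, card_filter _ (powerset _)]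
  rw [range_add_one, sum_powerset_insert notMem_range_self]
  have hlt : ∀ t ∈ (range n).powerset, ∀ a ∈ t, a < n :=
    fun t ht a ha => mem_range.1 (mem_powerset.1 ht ha)
  have hnt : ∀ t ∈ (range n).powerset, n ∉ t := fun t ht h => lt_irrefl _ (hlt t ht n h)
  congr 1
  · refine sum_congr rfl fun t ht => ?_
    have hlt := hlt t ht
    congr 1
    simp only [Nat.testBit_mod_two_pow, Bool.and_eq_true, decide_eq_true_eq]
    grind
  split_ifs with hp hj
  · refine sum_eq_zero fun t ht => if_neg ?_
    rintro ⟨-, h, -⟩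
    rw [filter_insert, if_pos hp, card_insert_of_notMem (by simp [hnt t ht])] at h
    omega
  all_goals
    refine sum_congr rfl fun t ht => ?_
    have hlt := hlt t ht
    congr 1
    rw [filter_insert, card_insert_of_notMem (hnt t ht)]
    simp only [hp, if_true, Bool.false_eq_true, if_false, forall_mem_insert, hc, hrefl,
      Nat.testBit_and, Nat.testBit_mod_two_pow, Bool.and_eq_true, decide_eq_true_eq, true_and]
  · rw [card_insert_of_notMem (by simp [hnt t ht])]
    grind
  · grind

open Finset in
theorem cliqueCount_eq_card (adj : ℕ → ℕ) (p N : ℕ)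
    (hrefl : ∀ a < N, (adj a).testBit a)
    (hsymm : ∀ a < N, ∀ b < N, (adj a).testBit b → (adj b).testBit a) :
    ∀ n ≤ N, ∀ k j c, c < 2 ^ n →
      cliqueCount adj p n k j c = #(maskCliques adj p n k j c) := by
  intro n
  induction n with
  | zero =>
    rintro - (_ | k) j c -
    · rw [cliqueCount, card_maskCliques_zero]
    · simp [cliqueCount, maskCliques, filter_singleton]
  | succ n ih =>
    rintro hn (_ | k) j (_ | c) hc
    · rw [cliqueCount, card_maskCliques_zero]
    · rw [cliqueCount, card_maskCliques_zero]
    · rw [cliqueCount, maskCliques_eq_of_lt adj p (Nat.zero_le _) _ _ (by simp)]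
      simp [maskCliques, filter_singleton]
    · rw [cliqueCount]
      have hlog : (c + 1).log2 ≤ n :=
        Nat.lt_succ_iff.1 ((Nat.log2_lt (Nat.succ_ne_zero c)).2 hc)
      have hbit : (c + 1).testBit (c + 1).log2 := Nat.testBit_log2 (Nat.succ_ne_zero c)
      have hlt : c + 1 < 2 ^ ((c + 1).log2 + 1) := Nat.lt_log2_self
      generalize (c + 1).log2 = a at hlog hbit hlt ⊢
      have hmod : (c + 1) % 2 ^ a < 2 ^ a := Nat.mod_lt _ (by positivity)
      have hand : (c + 1) % 2 ^ a &&& adj a < 2 ^ a := Nat.and_le_left.trans_lt hmod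
      have hpow : 2 ^ a ≤ 2 ^ n := Nat.pow_le_pow_right two_pos hlog
      simp only [ih (by omega) _ _ _ (hmod.trans_le hpow), ih (by omega) _ _ _ (hand.trans_le hpow),
        maskCliques_eq_of_lt adj p hlog _ _ hmod, maskCliques_eq_of_lt adj p hlog _ _ hand]
      rw [maskCliques_eq_of_lt adj p (by omega : a + 1 ≤ n + 1) _ _ hlt,
        card_maskCliques_succ adj p a k j _ (hrefl a (by omega))
          (fun b hb => hsymm a (by omega) b (by omega)) hbit]

/-- The vertices of `Γ`, slice by slice: `vertex (6 * t + s)` is the image under `τ ^ t` of the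
`s`-th vertex of the first slice, for `t < 7` and `s < 6`. -/
def vertex (a : ℕ) : Dg := tau7^[a / 6] (firstSlice.getD (a % 6) (dg 1 3 Colour.P))

/-- The translation `τ` on indices of vertices. -/
def tauIndex (a : ℕ) : ℕ :=
  if a < 36 then a + 6 else [0, 1, 4, 5, 2, 3].getD (a - 36) 0

/-- Bit `b` of `compatMask a` says whether `Ext(vertex a, vertex b)` vanishes. -/
def compatMask (a : ℕ) : ℕ :=
  [44034154431, 68719644479, 1066227863103, 2181594012735, 3514365414207, 3843148714815,
   2818185883584, 10735553, 2267885572083, 3282574970871, 619014442959, 4068959637471,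
   43989594153, 687075392, 9141746889, 3376612113915, 34505749473, 928672643055, 2815334025792,
   43972825088, 585071800896, 598896246477, 2208367966272, 2260444511217, 4259517206568,
   2814260805632, 2260223168544, 3144987685728, 598061486088, 3930960362568, 4328264043069,
   4190831116328, 3916794431496, 3367118886969, 3091563020832, 892812071469, 4330015068030,
   4330400778812, 4384238993964, 4389376233036, 4345986844728, 4363414440816].getD a 0

theorem inPi_iff (d : Dg) : InPi d ↔ ∃ a < 42, vertex a = d := by
  constructor
  · rintro ⟨i, h⟩
    have key : ∀ i : ZMod 7, ∀ d ∈ ([⟨i, i + 2, Colour.P⟩, ⟨i, i + 3, Colour.P⟩,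
        ⟨i, i + 4, Colour.R⟩, ⟨i, i + 5, Colour.R⟩, ⟨i + 4, i, Colour.B⟩,
        ⟨i + 5, i, Colour.B⟩] : List Dg), ∃ a < 42, vertex a = d := by
      decide +kernel
    exact key i d (by simpa using h)
  · rintro ⟨a, ha, rfl⟩
    have key : ∀ a < 42, ∃ i : ZMod 7, vertex a = ⟨i, i + 2, Colour.P⟩ ∨
        vertex a = ⟨i, i + 3, Colour.P⟩ ∨ vertex a = ⟨i, i + 4, Colour.R⟩ ∨
        vertex a = ⟨i, i + 5, Colour.R⟩ ∨ vertex a = ⟨i + 4, i, Colour.B⟩ ∨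
        vertex a = ⟨i + 5, i, Colour.B⟩ := by
      decide +kernel
    exact key a ha

theorem vertex_injOn : ∀ a < 42, ∀ b < 42, vertex a = vertex b → a = b := by
  decide +kernel

theorem tauIndex_lt : ∀ a < 42, tauIndex a < 42 := by
  decide +kernel

theorem tau7_vertex : ∀ a < 42, tau7 (vertex a) = vertex (tauIndex a) := by
  decide +kernel

theorem tauIndex_iterate_lt (k : ℕ) {a : ℕ} (ha : a < 42) : tauIndex^[k] a < 42 := by
  induction k with
  | zero => exact ha
  | succ k ih =>
    rw [Function.iterate_succ_apply']
    exact tauIndex_lt _ ih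

theorem tau7_iterate_vertex (k : ℕ) {a : ℕ} (ha : a < 42) :
    tau7^[k] (vertex a) = vertex (tauIndex^[k] a) := by
  induction k with
  | zero => rfl
  | succ k ih =>
    rw [Function.iterate_succ_apply', Function.iterate_succ_apply', ih,
      tau7_vertex _ (tauIndex_iterate_lt k ha)]

theorem tauIndex_iterate_div : ∀ a < 42, tauIndex^[a / 6] (a % 6) = a := by
  decide +kernel

theorem tauIndex_iterate_fourteen : ∀ a < 42, tauIndex^[14] a = a := by
  decide +kernel

theorem testBit_compatMask_tauIndex : ∀ a < 42, ∀ b < 42,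
    (compatMask (tauIndex a)).testBit (tauIndex b) = (compatMask a).testBit b := by
  decide +kernel

theorem testBit_compatMask_iterate (k : ℕ) {a b : ℕ} (ha : a < 42) (hb : b < 42) :
    (compatMask (tauIndex^[k] a)).testBit (tauIndex^[k] b) = (compatMask a).testBit b := by
  induction k with
  | zero => rfl
  | succ k ih =>
    rw [Function.iterate_succ_apply', Function.iterate_succ_apply',
      testBit_compatMask_tauIndex _ (tauIndex_iterate_lt k ha) _ (tauIndex_iterate_lt k hb), ih]

theorem testBit_compatMask_firstSlice : ∀ s < 6, ∀ z < 42,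
    (compatMask s).testBit z = false ↔ ∃ C ∈ curvesBase (vertex s), vertex z ∈ C := by
  decide +kernel

theorem exists_vertex_of_mem_curve : ∀ s < 6, ∀ C ∈ curvesBase (vertex s), ∀ z ∈ C,
    ∃ a < 42, vertex a = z := by
  decide +kernel

theorem length_curvesBase_le : ∀ s < 6, (curvesBase (vertex s)).length ≤ 4 := by
  decide +kernel

theorem mem_firstSlice_iff (d : Dg) : d ∈ firstSlice ↔ ∃ s < 6, vertex s = d := by
  have h : firstSlice = (List.range 6).map vertex := by decide +kernel
  simp [h]

theorem exists_curveMem_iff {a b : ℕ} (ha : a < 42) (hb : b < 42) :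
    (∃ n < 4, CurveMem (vertex a) n (vertex b)) ↔ (compatMask a).testBit b = false := by
  constructor
  · rintro ⟨n, -, k, d, C, z, hd, hX, hC, hz, hY⟩
    obtain ⟨s, hs, rfl⟩ := (mem_firstSlice_iff d).1 hd
    have hCmem := List.mem_of_getElem? hC
    obtain ⟨z, hz42, rfl⟩ := exists_vertex_of_mem_curve s hs C hCmem z hz
    have hs42 : s < 42 := by omega
    rw [tau7_iterate_vertex k hs42] at hX
    rw [tau7_iterate_vertex k hz42] at hY
    obtain rfl := vertex_injOn _ (tauIndex_iterate_lt k hs42) _ ha hX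
    obtain rfl := vertex_injOn _ (tauIndex_iterate_lt k hz42) _ hb hY
    rw [testBit_compatMask_iterate k hs42 hz42]
    exact (testBit_compatMask_firstSlice s hs z hz42).2 ⟨C, hCmem, hz⟩
  · intro h
    set k := a / 6 with hk
    have hs : a % 6 < 6 := Nat.mod_lt _ (by norm_num)
    have hz := tauIndex_iterate_lt (14 - k) hb
    have hkb : tauIndex^[k] (tauIndex^[14 - k] b) = b := by
      rw [← Function.iterate_add_apply, show k + (14 - k) = 14 by omega,
        tauIndex_iterate_fourteen b hb]
    have hka := tauIndex_iterate_div a ha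
    rw [← hk] at hka
    rw [← hka, ← hkb, testBit_compatMask_iterate k (by omega) hz,
      testBit_compatMask_firstSlice _ hs _ hz] at h
    obtain ⟨C, hC, hzC⟩ := h
    obtain ⟨n, hn, rfl⟩ := List.mem_iff_getElem.1 hC
    refine ⟨n, hn.trans_le (length_curvesBase_le _ hs), k, vertex (a % 6), _, _,
      (mem_firstSlice_iff _).2 ⟨_, hs, rfl⟩, ?_, List.getElem?_eq_getElem hn, hzC, ?_⟩
    · rw [tau7_iterate_vertex k (by omega), hka]
    · rw [tau7_iterate_vertex k hz, hkb]

theorem extDim_vertex_eq_zero_iff {a b : ℕ} (ha : a < 42) (hb : b < 42) :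
    extDim (vertex a) (vertex b) = 0 ↔ (compatMask a).testBit b := by
  rw [← Bool.not_eq_false, ← exists_curveMem_iff ha hb]
  simp [extDim, Finset.filter_eq_empty_iff]

open Finset in
theorem vertex_image_injOn :
    Set.InjOn (fun S : Finset ℕ => S.image vertex) {S | S ⊆ range 42} := by
  intro S hS T hT h
  have hinj : Set.InjOn vertex (range 42 : Finset ℕ) := fun a ha b hb =>
    vertex_injOn a (by simpa using ha) b (by simpa using hb)
  have hS' : (S : Set ℕ) ⊆ (range 42 : Finset ℕ) := by exact_mod_cast hS
  have hT' : (T : Set ℕ) ⊆ (range 42 : Finset ℕ) := by exact_mod_cast hT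
  have h' : vertex '' S = vertex '' T := by
    have := congrArg (fun U : Finset Dg => (U : Set Dg)) h
    simpa using this
  exact_mod_cast (hinj.image_eq_image_iff hS' hT').1 h'

open Finset in
theorem isConfig_image_vertex_iff {S : Finset ℕ} (hS : S ⊆ range 42) :
    IsConfig (S.image vertex) ↔ #S = 6 ∧ ∀ a ∈ S, ∀ b ∈ S, (compatMask a).testBit b := by
  have hlt : ∀ a ∈ S, a < 42 := fun a ha => mem_range.1 (hS ha)
  have hcard : #(S.image vertex) = #S :=
    card_image_of_injOn fun a ha b hb => vertex_injOn a (hlt a ha) b (hlt b hb)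
  simp only [IsConfig, hcard, forall_mem_image]
  refine and_congr_right fun _ => ⟨fun h a ha b hb => ?_, fun h => ⟨fun a ha => ?_, ?_⟩⟩
  · exact (extDim_vertex_eq_zero_iff (hlt a ha) (hlt b hb)).1 (h.2 ha hb)
  · exact (inPi_iff _).2 ⟨a, hlt a ha, rfl⟩
  · exact fun a ha b hb => (extDim_vertex_eq_zero_iff (hlt a ha) (hlt b hb)).2 (h a ha b hb)

open Finset in
theorem IsConfig.exists_image_vertex {T : Finset Dg} (hT : IsConfig T) :
    ∃ S ⊆ range 42, S.image vertex = T := by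
  refine ⟨{a ∈ range 42 | vertex a ∈ T}, filter_subset _ _, ?_⟩
  ext d
  simp only [mem_image, mem_filter, mem_range]
  constructor
  · rintro ⟨a, ⟨-, h⟩, rfl⟩
    exact h
  · intro hd
    obtain ⟨a, ha, rfl⟩ := (inPi_iff d).1 (hT.2.1 d hd)
    exact ⟨a, ⟨ha, hd⟩, rfl⟩

theorem testBit_compatMask_self : ∀ a < 42, (compatMask a).testBit a := by
  decide +kernel

theorem testBit_compatMask_symm : ∀ a < 42, ∀ b < 42,
    (compatMask a).testBit b → (compatMask b).testBit a := by
  decide +kernel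

open Finset in
/-- The cluster configurations cut out by a property of the occurring indices are counted by
`cliqueCount`. -/
theorem ncard_isConfig_and (Q : Finset Dg → Prop) (p j c : ℕ) (hc : c < 2 ^ 42)
    (hQ : ∀ S ⊆ range 42, Q (S.image vertex) ↔
      #{a ∈ S | p.testBit a} = j ∧ ∀ a ∈ S, c.testBit a) :
    Set.ncard {T : Finset Dg | IsConfig T ∧ Q T} = cliqueCount compatMask p 42 6 j c := by
  have h : {T : Finset Dg | IsConfig T ∧ Q T} =
      (fun S : Finset ℕ => S.image vertex) '' (maskCliques compatMask p 42 6 j c) := by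
    ext T
    simp only [Set.mem_ofPred_eq, Set.mem_image, maskCliques, coe_filter, mem_powerset]
    constructor
    · rintro ⟨hT, hQT⟩
      obtain ⟨S, hS, rfl⟩ := hT.exists_image_vertex
      rw [hQ S hS] at hQT
      rw [isConfig_image_vertex_iff hS] at hT
      exact ⟨S, ⟨hS, hT.1, hQT.1, hQT.2, hT.2⟩, rfl⟩
    · rintro ⟨S, ⟨hS, h6, hj, hc, hadj⟩, rfl⟩
      exact ⟨(isConfig_image_vertex_iff hS).2 ⟨h6, hadj⟩, (hQ S hS).2 ⟨hj, hc⟩⟩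
  rw [h, Set.InjOn.ncard_image, Set.ncard_coe_finset, cliqueCount_eq_card compatMask p 42
    testBit_compatMask_self testBit_compatMask_symm 42 le_rfl _ _ _ hc]
  exact vertex_image_injOn.mono fun S hS => by
    simp only [maskCliques, coe_filter, mem_powerset, Set.mem_ofPred_eq] at hS
    exact hS.1

/-- The bit mask of the indices of short paired diagonals. -/
def shortMask : ℕ := 69810262081

/-- The bit mask of the indices of vertices other than long paired diagonals. -/
def nonLongMask : ℕ := 4258425986941

/-- The bit mask of the indices of single diagonals. -/
def singleMask : ℕ := 4188615724860

theorem isShortPaired_vertex_iff : ∀ a < 42, IsShortPaired (vertex a) ↔ shortMask.testBit a := by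
  unfold IsShortPaired
  decide +kernel

theorem not_isLongPaired_vertex_iff :
    ∀ a < 42, ¬ IsLongPaired (vertex a) ↔ nonLongMask.testBit a := by
  unfold IsLongPaired
  decide +kernel

theorem vertex_c_ne_iff : ∀ a < 42, (vertex a).c ≠ Colour.P ↔ singleMask.testBit a := by
  decide +kernel

open Finset in
theorem shortCount_image_vertex {S : Finset ℕ} (hS : S ⊆ range 42) :
    shortCount (S.image vertex) = #{a ∈ S | shortMask.testBit a} := by
  classical
  have hlt : ∀ a ∈ S, a < 42 := fun a ha => mem_range.1 (hS ha)
  have hfilter : {a ∈ S | IsShortPaired (vertex a)} = {a ∈ S | shortMask.testBit a} :=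
    filter_congr fun a ha => isShortPaired_vertex_iff a (hlt a ha)
  rw [shortCount, filter_image, ← hfilter]
  convert card_image_of_injOn ?_
  exact fun a ha b hb => vertex_injOn a (hlt a (mem_filter.1 ha).1) b (hlt b (mem_filter.1 hb).1)

open Finset in
theorem not_hasLong_image_vertex_iff {S : Finset ℕ} (hS : S ⊆ range 42) :
    ¬ HasLong (S.image vertex) ↔ ∀ a ∈ S, nonLongMask.testBit a := by
  simp only [HasLong, not_exists, not_and, forall_mem_image]
  exact forall₂_congr fun a ha => not_isLongPaired_vertex_iff a (mem_range.1 (hS ha))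

theorem ncard_not_hasLong_shortCount (j : ℕ) :
    Set.ncard {T : Finset Dg | IsConfig T ∧ ¬ HasLong T ∧ shortCount T = j} =
      cliqueCount compatMask shortMask 42 6 j nonLongMask :=
  ncard_isConfig_and _ _ _ _ (by decide) fun S hS => by
    rw [not_hasLong_image_vertex_iff hS, shortCount_image_vertex hS, and_comm]

theorem ncard_no_paired :
    Set.ncard {T : Finset Dg | IsConfig T ∧ ∀ d ∈ T, d.c ≠ Colour.P} =
      cliqueCount compatMask 0 42 6 0 singleMask :=
  ncard_isConfig_and _ _ _ _ (by decide) fun S hS => by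
    simp only [Finset.forall_mem_image, Nat.zero_testBit, Bool.false_eq_true, Finset.filter_false,
      Finset.card_empty, true_and]
    exact forall₂_congr fun a ha => vertex_c_ne_iff a (Finset.mem_range.1 (hS ha))

theorem ncard_not_hasLong :
    Set.ncard {T : Finset Dg | IsConfig T ∧ ¬ HasLong T} =
      cliqueCount compatMask 0 42 6 0 nonLongMask :=
  ncard_isConfig_and _ _ _ _ (by decide) fun S hS => by
    simp [not_hasLong_image_vertex_iff hS]

theorem ncard_isConfig :
    Set.ncard {T : Finset Dg | IsConfig T} =
      cliqueCount compatMask 0 42 6 0 (2 ^ 42 - 1) := by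
  have h := ncard_isConfig_and (fun _ => True) 0 0 (2 ^ 42 - 1) (by norm_num) fun S hS => by
    simp only [Nat.zero_testBit, Bool.false_eq_true, Finset.filter_false, Finset.card_empty,
      true_and, true_iff, Nat.testBit_two_pow_sub_one, decide_eq_true_eq]
    exact fun a ha => Finset.mem_range.1 (hS ha)
  simpa using h

theorem ncard_hasLong_add :
    Set.ncard {T : Finset Dg | IsConfig T ∧ HasLong T} +
      Set.ncard {T : Finset Dg | IsConfig T ∧ ¬ HasLong T} =
      Set.ncard {T : Finset Dg | IsConfig T} := by
  have hfin : {T : Finset Dg | IsConfig T}.Finite :=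
    ((Finset.range 42).powerset.finite_toSet.image fun S => S.image vertex).subset fun T hT => by
      obtain ⟨S, hS, rfl⟩ := IsConfig.exists_image_vertex hT
      exact ⟨S, Finset.mem_coe.2 (Finset.mem_powerset.2 hS), rfl⟩
  rw [← Set.ncard_inter_add_ncard_sdiff_eq_ncard {T | IsConfig T} {T | HasLong T} hfin]
  rfl

/-- Corollary 5.8.  Among the cluster configurations of
the regular heptagon `Π`: exactly `224` contain precisely one short paired
diagonal and no long paired diagonal; exactly `175` contain precisely two
short paired diagonals and no long paired diagonal; and exactly `84` contain
no paired diagonal at all.  All these cluster configurations are pairwise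
distinct (the three families are pairwise disjoint), and together with the
`350` configurations containing a long paired diagonal they account for all
`833` cluster configurations. -/
theorem counts_by_paired_diagonals :
    Set.ncard {T : Finset Dg | IsConfig T ∧ ¬ HasLong T ∧ shortCount T = 1}
      = 224 ∧
    Set.ncard {T : Finset Dg | IsConfig T ∧ ¬ HasLong T ∧ shortCount T = 2}
      = 175 ∧
    Set.ncard {T : Finset Dg | IsConfig T ∧ ∀ d ∈ T, d.c ≠ Colour.P} = 84 ∧
    (∀ T : Finset Dg, IsConfig T → (∀ d ∈ T, d.c ≠ Colour.P) →
      ¬ HasLong T ∧ shortCount T = 0) ∧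
    Set.ncard {T : Finset Dg | IsConfig T ∧ HasLong T} = 350 ∧
    Set.ncard {T : Finset Dg | IsConfig T} = 833 := by
  have hall : Set.ncard {T : Finset Dg | IsConfig T} = 833 :=
    ncard_isConfig.trans (by decide +kernel)
  have hnonlong : Set.ncard {T : Finset Dg | IsConfig T ∧ ¬ HasLong T} = 483 :=
    ncard_not_hasLong.trans (by decide +kernel)
  have hadd := ncard_hasLong_add
  refine ⟨(ncard_not_hasLong_shortCount 1).trans (by decide +kernel),
    (ncard_not_hasLong_shortCount 2).trans (by decide +kernel),
    ncard_no_paired.trans (by decide +kernel), fun T _ hP => ⟨?_, ?_⟩, by omega, hall⟩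
  · rintro ⟨d, hd, hlong⟩
    exact hP d hd hlong.1
  · simp only [shortCount, Finset.card_eq_zero, Finset.filter_eq_empty_iff]
    exact fun d hd hshort => hP d hd hshort.1
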